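/- arXiv:1701.05290 — 3 statements merged into one kernel-verified Lean document; each statement's English description precedes it below -/
import Mathlib

section
/- Let I be a finite linearly ordered set, let 0 < ε ≤ 1 and 0 < α ≤ 1 be reals, and let p* ≥ 1 be a real number with |I| ≥ 1100·p*/(ε³·α). On a probability space let I' be a random subset of I such that the events {x ∈ I'} for x ∈ I are pairwise independent, each with probability 1/p*, and independently let f be a random function from I to ℕ that is (ε/4)-minwise independent, i.e. for every nonempty A ⊆ I and every y ∈ A, Pr[y = m_f(A)] lies in [(1−ε/4)/|A|, (1+ε/4)/|A|], where m_f(A) denotes the least element of A attaining the minimum of f on A. For S ⊆ I define H*(S) = m_f(I' ∩ S) when I' ∩ S is nonempty, and H*(S) = ⊥ (a common default value) when I' ∩ S is empty. Then for all S, T ⊆ I with |S| ≥ α|I| and |T| ≥ α|I|, the probability Pr[H*(S) = H*(T)] differs from the Jaccard similarity J = |S∩T|/|S∪T| by at most ε. -/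
open MeasureTheory Finset

/-- The min-hash of a nonempty finite set `A` under `f`: the least element of `A`
attaining the minimum of `f` on `A`. -/
noncomputable def minHash {ι : Type*} [LinearOrder ι] (f : ι → ℕ) (A : Finset ι)
    (h : A.Nonempty) : ι :=
  (A.filter fun y => f y = A.inf' h f).min' (by
    obtain ⟨y, hy, hfy⟩ := Finset.exists_mem_eq_inf' h f
    exact ⟨y, Finset.mem_filter.2 ⟨hy, hfy.symm⟩⟩)

/-- The min-hash as an `Option`, with value `none` (the default `⊥`) on the empty set. -/
noncomputable def minHashOpt {ι : Type*} [LinearOrder ι] (f : ι → ℕ) (A : Finset ι) :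
    Option ι :=
  if h : A.Nonempty then some (minHash f A h) else none

section MinHash

variable {ι : Type*} [LinearOrder ι]

lemma minHashOpt_eq_some_iff (f : ι → ℕ) (A : Finset ι) (y : ι) :
    minHashOpt f A = some y ↔ y ∈ A ∧ ∀ z ∈ A, f y < f z ∨ (f y = f z ∧ y ≤ z) := by
  unfold minHashOpt
  split_ifs with h
  · rw [Option.some_inj, minHash, Finset.min'_eq_iff]
    simp only [Finset.mem_filter, and_imp]
    constructor
    · rintro ⟨⟨hy, hfy⟩, hmin⟩
      refine ⟨hy, fun z hz => ?_⟩
      have hle : f y ≤ f z := hfy ▸ Finset.inf'_le f hz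
      rcases hle.lt_or_eq with hlt | heq
      · exact Or.inl hlt
      · exact Or.inr ⟨heq, hmin z hz (heq ▸ hfy)⟩
    · rintro ⟨hy, hmin⟩
      have hfy : f y = A.inf' h f := by
        refine le_antisymm (Finset.le_inf' h f fun z hz => ?_) (Finset.inf'_le f hy)
        rcases hmin z hz with hlt | heq
        · exact hlt.le
        · exact heq.1.le
      refine ⟨⟨hy, hfy⟩, fun z hz hfz => ?_⟩
      rcases hmin z hz with hlt | heq
      · omega
      · exact heq.2
  · rw [Finset.not_nonempty_iff_eq_empty] at h
    simp [h]

lemma minHashOpt_eq_none_iff (f : ι → ℕ) (A : Finset ι) :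
    minHashOpt f A = none ↔ A = ∅ := by
  unfold minHashOpt
  split_ifs with h
  · simpa using h.ne_empty
  · simpa using Finset.not_nonempty_iff_eq_empty.1 h

lemma minHashOpt_eq_minHashOpt_iff (f : ι → ℕ) {A B : Finset ι} (h : (A ∪ B).Nonempty) :
    minHashOpt f A = minHashOpt f B ↔ ∃ y ∈ A ∩ B, minHashOpt f (A ∪ B) = some y := by
  constructor
  · intro hAB
    cases hA : minHashOpt f A with
    | none =>
      have hB := hAB ▸ hA
      rw [minHashOpt_eq_none_iff] at hA hB
      simp [hA, hB] at h
    | some y =>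
      have hB := hAB ▸ hA
      rw [minHashOpt_eq_some_iff] at hA hB
      refine ⟨y, Finset.mem_inter.2 ⟨hA.1, hB.1⟩, (minHashOpt_eq_some_iff ..).2
        ⟨Finset.mem_union_left _ hA.1, fun z hz => ?_⟩⟩
      exact (Finset.mem_union.1 hz).elim (hA.2 z) (hB.2 z)
  · rintro ⟨y, hy, hAB⟩
    rw [Finset.mem_inter] at hy
    rw [minHashOpt_eq_some_iff] at hAB
    rw [(minHashOpt_eq_some_iff f A y).2
        ⟨hy.1, fun z hz => hAB.2 z (Finset.mem_union_left _ hz)⟩,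
      (minHashOpt_eq_some_iff f B y).2
        ⟨hy.2, fun z hz => hAB.2 z (Finset.mem_union_right _ hz)⟩]

end MinHash

/-- The collision probability of two min-hashes under a `δ`-minwise independent function. -/
lemma abs_collision_sub_le {ι Ω : Type*} [LinearOrder ι] [Finite ι] [MeasurableSpace Ω]
    (μ : Measure Ω) [IsProbabilityMeasure μ] (f : Ω → ι → ℕ) (hf : Measurable f) (δ : ℝ)
    (hminwise : ∀ (A : Finset ι) (y : ι), y ∈ A →
      (μ {ω | minHashOpt (f ω) A = some y}).toReal ∈
        Set.Icc ((1 - δ) / (A.card : ℝ)) ((1 + δ) / (A.card : ℝ)))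
    {A B : Finset ι} (h : (A ∪ B).Nonempty) :
    |μ.real {ω | minHashOpt (f ω) A = minHashOpt (f ω) B}
        - ((A ∩ B).card : ℝ) / ((A ∪ B).card : ℝ)|
      ≤ δ * (((A ∩ B).card : ℝ) / ((A ∪ B).card : ℝ)) := by
  have hset : {ω | minHashOpt (f ω) A = minHashOpt (f ω) B}
      = ⋃ y ∈ A ∩ B, {ω | minHashOpt (f ω) (A ∪ B) = some y} := by
    ext ω
    simp only [Set.mem_ofPred_eq, Set.mem_iUnion, exists_prop]
    exact minHashOpt_eq_minHashOpt_iff (f ω) h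
  rw [hset, measureReal_biUnion_finset]
  · have hbd : ∀ y ∈ A ∩ B, μ.real {ω | minHashOpt (f ω) (A ∪ B) = some y} ∈
        Set.Icc ((1 - δ) / ((A ∪ B).card : ℝ)) ((1 + δ) / ((A ∪ B).card : ℝ)) := fun y hy =>
      hminwise _ y (Finset.mem_union_left _ (Finset.mem_inter.1 hy).1)
    have hlo := Finset.card_nsmul_le_sum _ _ _ fun y hy => (hbd y hy).1
    have hhi := Finset.sum_le_card_nsmul _ _ _ fun y hy => (hbd y hy).2
    rw [nsmul_eq_mul] at hlo hhi
    rw [abs_le]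
    constructor
    · calc _ = ((A ∩ B).card : ℝ) * ((1 - δ) / ((A ∪ B).card : ℝ))
            - ((A ∩ B).card : ℝ) / ((A ∪ B).card : ℝ) := by ring
        _ ≤ _ := by linarith
    · calc _ ≤ ((A ∩ B).card : ℝ) * ((1 + δ) / ((A ∪ B).card : ℝ))
            - ((A ∩ B).card : ℝ) / ((A ∪ B).card : ℝ) := by linarith
        _ = _ := by ring
  · intro y _ z _ hyz
    refine Set.disjoint_left.2 fun ω hy hz => hyz ?_
    exact Option.some_inj.1 ((show minHashOpt (f ω) (A ∪ B) = some y from hy).symm.trans hz)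
  · intro y _
    exact hf (Set.to_countable {g : ι → ℕ | minHashOpt g (A ∪ B) = some y}).measurableSet

/-- Independence on atoms extends to arbitrary events of a countably-valued variable. -/
lemma measure_inter_preimage_eq_mul {Ω β : Type*} [MeasurableSpace Ω] [MeasurableSpace β]
    [Countable β] [MeasurableSingletonClass β] (μ : Measure Ω) {f : Ω → β} (hf : Measurable f)
    {E : Set Ω} (h : ∀ g, μ (E ∩ {ω | f ω = g}) = μ E * μ {ω | f ω = g}) (G : Set β) :
    μ (E ∩ f ⁻¹' G) = μ E * μ (f ⁻¹' G) := by
  have hmap : (μ.restrict E).map f = μ E • μ.map f := by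
    refine Measure.ext_of_singleton fun g => ?_
    have hg := h g
    rw [Measure.map_apply hf (measurableSet_singleton g),
      Measure.restrict_apply (hf (measurableSet_singleton g)), Measure.smul_apply,
      Measure.map_apply hf (measurableSet_singleton g), Set.inter_comm]
    exact hg
  have hG := G.to_countable.measurableSet
  have := congrArg (fun ν => ν G) hmap
  simpa [Measure.map_apply hf hG, Measure.restrict_apply (hf hG), Set.inter_comm] using this

/-- Decomposition of a probability along a finitely-valued random variable. -/
lemma measureReal_eq_sum_inter {Ω β : Type*} [MeasurableSpace Ω] [Fintype β] (μ : Measure Ω)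
    [IsFiniteMeasure μ] (X : Ω → β) (hX : ∀ s, MeasurableSet {ω | X ω = s}) (E : Set Ω) :
    μ.real E = ∑ s, μ.real ({ω | X ω = s} ∩ E) := by
  have h := sum_measureReal_preimage_singleton (μ := μ.restrict E) (Finset.univ : Finset β)
    (f := X) (fun s _ => hX s)
  simp only [Finset.coe_univ, Set.preimage_univ, measureReal_restrict_apply_univ] at h
  exact h.symm.trans <| Finset.sum_congr rfl fun s _ => measureReal_restrict_apply (hX s)

/-- The probability of an event determined by a finitely-valued random variable. -/
lemma sum_measureReal_mul_ite {Ω β : Type*} [MeasurableSpace Ω] [Fintype β] (μ : Measure Ω)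
    [IsFiniteMeasure μ] (X : Ω → β) (hX : ∀ s, MeasurableSet {ω | X ω = s})
    (P : β → Prop) [DecidablePred P] :
    ∑ s, μ.real {ω | X ω = s} * (if P s then 1 else 0) = μ.real {ω | P (X ω)} := by
  rw [measureReal_eq_sum_inter μ X hX]
  refine Finset.sum_congr rfl fun s _ => ?_
  split_ifs with h
  · rw [mul_one]
    congr 1
    ext ω
    simp only [Set.mem_ofPred_eq, Set.mem_inter_iff]
    exact ⟨fun hs => ⟨hs, hs ▸ h⟩, fun hs => hs.1⟩
  · rw [mul_zero, eq_comm]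
    convert measureReal_empty (μ := μ)
    ext ω
    simp only [Set.mem_ofPred_eq, Set.mem_inter_iff, Set.mem_empty_iff_false, iff_false]
    rintro ⟨rfl, hs⟩
    exact h hs

lemma card_inter_eq_sum_ite {ι : Type*} [DecidableEq ι] (s A : Finset ι) :
    ((s ∩ A).card : ℝ) = ∑ x ∈ A, if x ∈ s then (1 : ℝ) else 0 := by
  rw [Finset.sum_boole, Finset.filter_mem_eq_inter, Finset.inter_comm]

section Moments

variable {ι : Type*} [Fintype ι] [DecidableEq ι] {w : Finset ι → ℝ} {r : ℝ}

/-- The expected size of the sample within `A`. -/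
lemma sum_mul_card_inter (hrate : ∀ x, ∑ s, w s * (if x ∈ s then 1 else 0) = r)
    (A : Finset ι) : ∑ s, w s * ((s ∩ A).card : ℝ) = A.card * r := by
  simp_rw [card_inter_eq_sum_ite, Finset.mul_sum]
  rw [Finset.sum_comm, Finset.sum_congr rfl fun x _ => hrate x, Finset.sum_const, nsmul_eq_mul]

/-- The variance of the size of a pairwise independent sample is at most its mean. -/
lemma sum_mul_sq_card_inter_sub_le (hw : ∑ s, w s = 1)
    (hrate : ∀ x, ∑ s, w s * (if x ∈ s then 1 else 0) = r)
    (hpair : ∀ x y, x ≠ y → ∑ s, w s * (if x ∈ s ∧ y ∈ s then 1 else 0) = r * r)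
    (A : Finset ι) :
    ∑ s, w s * (((s ∩ A).card : ℝ) - A.card * r) ^ 2 ≤ A.card * r := by
  have hsq : ∑ s, w s * ((s ∩ A).card : ℝ) ^ 2 ≤ A.card * r + (A.card * r) ^ 2 := by
    calc ∑ s, w s * ((s ∩ A).card : ℝ) ^ 2
        = ∑ x ∈ A, ∑ y ∈ A, ∑ s, w s * (if x ∈ s ∧ y ∈ s then 1 else 0) := by
          simp_rw [card_inter_eq_sum_ite, sq, Finset.sum_mul_sum, Finset.mul_sum]
          rw [Finset.sum_comm]
          refine Finset.sum_congr rfl fun x _ => ?_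
          rw [Finset.sum_comm]
          refine Finset.sum_congr rfl fun y _ => Finset.sum_congr rfl fun s _ => ?_
          by_cases hx : x ∈ s <;> by_cases hy : y ∈ s <;> simp [hx, hy]
      _ ≤ ∑ x ∈ A, ∑ y ∈ A, ((if x = y then r else 0) + r * r) := by
          refine Finset.sum_le_sum fun x _ => Finset.sum_le_sum fun y _ => ?_
          split_ifs with h
          · subst h
            simp only [and_self, hrate]
            nlinarith
          · rw [hpair x y h, zero_add]
      _ = ∑ x ∈ A, (r + A.card * (r * r)) := by
          refine Finset.sum_congr rfl fun x hx => ?_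
          rw [Finset.sum_add_distrib, Finset.sum_ite_eq, if_pos hx, Finset.sum_const,
            nsmul_eq_mul]
      _ = A.card * r + (A.card * r) ^ 2 := by
          rw [Finset.sum_const, nsmul_eq_mul]
          ring
  have hmean := sum_mul_card_inter hrate A
  calc ∑ s, w s * (((s ∩ A).card : ℝ) - A.card * r) ^ 2
      = ∑ s, w s * ((s ∩ A).card : ℝ) ^ 2
          - 2 * (A.card * r) * ∑ s, w s * ((s ∩ A).card : ℝ)
          + (A.card * r) ^ 2 * ∑ s, w s := by
        rw [Finset.mul_sum, Finset.mul_sum, ← Finset.sum_sub_distrib, ← Finset.sum_add_distrib]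
        exact Finset.sum_congr rfl fun s _ => by ring
    _ ≤ A.card * r := by
        rw [hmean, hw]
        nlinarith

end Moments

/-- Replacing the denominator `u` of `k / u` by `m` costs at most `|u - m| / m`, which is
bounded here by a quadratic expression in `u - m`. -/
lemma abs_sub_div_le_of_abs_sub_div_le {ε m k u q : ℝ} (hε : 0 < ε) (hm : 0 < m) (hu : 0 < u)
    (hk : 0 ≤ k) (hku : k ≤ u) (hq : |q - k / u| ≤ ε / 4 * (k / u)) :
    |q - k / m| ≤ ε / 2 + (u - m) ^ 2 * (1 / (ε * m ^ 2)) := by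
  have hR0 : 0 ≤ k / u := by positivity
  have hR1 : k / u ≤ 1 := (div_le_one hu).2 hku
  have hswap : |k / u - k / m| ≤ |u - m| / m := by
    have : k / u - k / m = k / u * ((m - u) / m) := by field_simp
    rw [this, abs_mul, abs_of_nonneg hR0, abs_div, abs_of_pos hm, abs_sub_comm m u]
    exact mul_le_of_le_one_left (by positivity) hR1
  have hquad : |u - m| / m ≤ ε / 4 + (u - m) ^ 2 * (1 / (ε * m ^ 2)) := by
    have : ε / 4 + (u - m) ^ 2 * (1 / (ε * m ^ 2)) - |u - m| / m
        = (ε / 2 - |u - m| / m) ^ 2 / ε := by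
      rw [← sq_abs (u - m)]
      field_simp
      ring
    have : 0 ≤ (ε / 2 - |u - m| / m) ^ 2 / ε := by positivity
    linarith
  have := abs_sub_le q (k / u) (k / m)
  nlinarith

/-- The transformation from 2-independent consistent sampling to locality-sensitive
hashing (Lemma 7): if `I'` is a pairwise-independent consistent sample of the finite
linearly ordered set `ι` with rate `1/p*`, `f` is an independent `(ε/4)`-minwise
independent random function, `|ι| ≥ 1100·p*/(ε³·α)`, and `S`, `T` are subsets of
density at least `α`, then the collision probability of `H*(S) = m_f(I' ∩ S)`
differs from the Jaccard similarity `|S∩T|/|S∪T|` by at most `ε`. -/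
theorem stmt2 {ι : Type*} [Fintype ι] [LinearOrder ι] {Ω : Type*} [MeasurableSpace Ω]
    (μ : Measure Ω) [IsProbabilityMeasure μ]
    (ε α pstar : ℝ) (hε0 : 0 < ε) (hε1 : ε ≤ 1) (hα0 : 0 < α) (hα1 : α ≤ 1)
    (hpstar : 1 ≤ pstar)
    (hcard : 1100 * pstar / (ε ^ 3 * α) ≤ (Fintype.card ι : ℝ))
    (I' : Ω → Finset ι) (f : Ω → ι → ℕ)
    (hI'meas : ∀ s : Finset ι, MeasurableSet {ω | I' ω = s})
    (hfmeas : ∀ x : ι, Measurable fun ω => f ω x)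
    -- each element is sampled with probability `1/p*` ...
    (hrate : ∀ x : ι, (μ {ω | x ∈ I' ω}).toReal = 1 / pstar)
    -- ... and the membership events are pairwise independent
    (hpairwise : ∀ x y : ι, x ≠ y →
      (μ ({ω | x ∈ I' ω} ∩ {ω | y ∈ I' ω})).toReal = (1 / pstar) * (1 / pstar))
    -- the random function `f` is independent of the random sample `I'`
    (hindep : ∀ (s : Finset ι) (g : ι → ℕ),
      μ ({ω | I' ω = s} ∩ {ω | f ω = g}) = μ {ω | I' ω = s} * μ {ω | f ω = g})
    -- `f` is `(ε/4)`-minwise independent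
    (hminwise : ∀ (A : Finset ι) (y : ι), y ∈ A →
      (μ {ω | minHashOpt (f ω) A = some y}).toReal ∈
        Set.Icc ((1 - ε / 4) / (A.card : ℝ)) ((1 + ε / 4) / (A.card : ℝ)))
    (S T : Finset ι)
    (hS : α * (Fintype.card ι : ℝ) ≤ (S.card : ℝ))
    (hT : α * (Fintype.card ι : ℝ) ≤ (T.card : ℝ)) :
    |(μ {ω | minHashOpt (f ω) (I' ω ∩ S) = minHashOpt (f ω) (I' ω ∩ T)}).toReal -
        ((S ∩ T).card : ℝ) / ((S ∪ T).card : ℝ)| ≤ ε := by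
  have hf : Measurable f := measurable_pi_lambda f hfmeas
  have hp : 0 < pstar := by linarith
  set r : ℝ := 1 / pstar with hr
  have hr0 : 0 < r := by positivity
  set w : Finset ι → ℝ := fun s => μ.real {ω | I' ω = s} with hwdef
  have hw0 : ∀ s, 0 ≤ w s := fun s => measureReal_nonneg
  have hw1 : ∑ s, w s = 1 := by
    have := measureReal_eq_sum_inter μ I' hI'meas Set.univ
    simpa [hwdef] using this.symm
  have hwrate : ∀ x, ∑ s, w s * (if x ∈ s then 1 else 0) = r := fun x =>
    (sum_measureReal_mul_ite μ I' hI'meas (fun s => x ∈ s)).trans (hrate x)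
  have hwpair : ∀ x y, x ≠ y → ∑ s, w s * (if x ∈ s ∧ y ∈ s then 1 else 0) = r * r :=
    fun x y hxy =>
      (sum_measureReal_mul_ite μ I' hI'meas (fun s => x ∈ s ∧ y ∈ s)).trans (hpairwise x y hxy)
  set q : Finset ι → ℝ := fun s =>
    μ.real {ω | minHashOpt (f ω) (s ∩ S) = minHashOpt (f ω) (s ∩ T)} with hqdef
  have hcoll : μ.real {ω | minHashOpt (f ω) (I' ω ∩ S) = minHashOpt (f ω) (I' ω ∩ T)}
      = ∑ s, w s * q s := by
    rw [measureReal_eq_sum_inter μ I' hI'meas]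
    refine Finset.sum_congr rfl fun s _ => ?_
    rw [hwdef, hqdef]
    simp only [Measure.real]
    rw [← ENNReal.toReal_mul]
    have := measure_inter_preimage_eq_mul μ hf (hindep s)
      {g | minHashOpt g (s ∩ S) = minHashOpt g (s ∩ T)}
    simp only [Set.preimage_ofPred_eq] at this
    rw [← this]
    congr 2
    ext ω
    simp only [Set.mem_inter_iff, Set.mem_ofPred_eq]
    constructor <;> (rintro ⟨rfl, h⟩; exact ⟨rfl, h⟩)
  set u : ℝ := ((S ∪ T).card : ℝ) with hu
  set m : ℝ := u * r with hm
  have hmlarge : 1100 ≤ ε ^ 3 * m := by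
    have hSu : (S.card : ℝ) ≤ u := by
      exact Nat.cast_le.2 (Finset.card_le_card Finset.subset_union_left)
    rw [div_le_iff₀ (by positivity)] at hcard
    have : 1100 * pstar ≤ ε ^ 3 * u := by
      nlinarith [mul_le_mul_of_nonneg_left (hS.trans hSu) (pow_pos hε0 3).le]
    rw [hm, hr, mul_one_div, mul_div_assoc', le_div_iff₀ hp]
    exact this
  have hm0 : 0 < m := pos_of_mul_pos_right (by linarith) (pow_pos hε0 3).le
  have hu0 : 0 < u := pos_of_mul_pos_left hm0 hr0.le
  have hpoint : ∀ s, |q s - ((s ∩ (S ∩ T)).card : ℝ) / m|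
      ≤ ε / 2 + (((s ∩ (S ∪ T)).card : ℝ) - m) ^ 2 * (1 / (ε * m ^ 2)) := by
    intro s
    rcases (s ∩ (S ∪ T)).eq_empty_or_nonempty with he | hne
    · have hS' : s ∩ S = ∅ := Finset.subset_empty.1
        (he ▸ Finset.inter_subset_inter_left Finset.subset_union_left)
      have hT' : s ∩ T = ∅ := Finset.subset_empty.1
        (he ▸ Finset.inter_subset_inter_left Finset.subset_union_right)
      have hK : s ∩ (S ∩ T) = ∅ := Finset.subset_empty.1
        (hS' ▸ Finset.inter_subset_inter_left Finset.inter_subset_left)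
      have hq1 : q s = 1 := by simp [hqdef, hS', hT']
      have hquad : (0 - m) ^ 2 * (1 / (ε * m ^ 2)) = 1 / ε := by field_simp; ring
      have : 1 ≤ 1 / ε := (one_le_div hε0).2 hε1
      simp only [hq1, hK, he, Finset.card_empty, Nat.cast_zero, zero_div, sub_zero, abs_one,
        hquad]
      linarith
    · have hne' : (s ∩ S ∪ s ∩ T).Nonempty := by rwa [← Finset.inter_union_distrib_left]
      have := abs_collision_sub_le μ f hf (ε / 4) hminwise hne'
      rw [← Finset.inter_union_distrib_left, ← Finset.inter_inter_distrib_left] at this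
      refine abs_sub_div_le_of_abs_sub_div_le hε0 hm0 (by exact_mod_cast hne.card_pos)
        (Nat.cast_nonneg _) ?_ this
      exact_mod_cast Finset.card_le_card (Finset.inter_subset_inter_left
        (Finset.inter_subset_left.trans Finset.subset_union_left))
  have hJ : ((S ∩ T).card : ℝ) / u = ∑ s, w s * (((s ∩ (S ∩ T)).card : ℝ) / m) := by
    simp_rw [← mul_div_assoc]
    rw [← Finset.sum_div, sum_mul_card_inter hwrate, hm, mul_div_mul_right _ _ hr0.ne']
  have hvar := sum_mul_sq_card_inter_sub_le hw1 hwrate hwpair (S ∪ T)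
  rw [← hu, ← hm] at hvar
  change |μ.real _ - _| ≤ ε
  rw [hcoll, hJ, ← Finset.sum_sub_distrib]
  calc |∑ s, (w s * q s - w s * (((s ∩ (S ∩ T)).card : ℝ) / m))|
      ≤ ∑ s, |w s * q s - w s * (((s ∩ (S ∩ T)).card : ℝ) / m)| :=
        Finset.abs_sum_le_sum_abs _ _
    _ ≤ ∑ s, w s * (ε / 2 + (((s ∩ (S ∪ T)).card : ℝ) - m) ^ 2 * (1 / (ε * m ^ 2))) := by
        refine Finset.sum_le_sum fun s _ => ?_
        rw [← mul_sub, abs_mul, abs_of_nonneg (hw0 s)]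
        exact mul_le_mul_of_nonneg_left (hpoint s) (hw0 s)
    _ = ε / 2 + (∑ s, w s * (((s ∩ (S ∪ T)).card : ℝ) - m) ^ 2) * (1 / (ε * m ^ 2)) := by
        simp_rw [mul_add, ← mul_assoc]
        rw [Finset.sum_add_distrib, ← Finset.sum_mul, ← Finset.sum_mul]
        simp [hw1]
    _ ≤ ε / 2 + m * (1 / (ε * m ^ 2)) := by gcongr
    _ = ε / 2 + 1 / (ε * m) := by field_simp
    _ ≤ ε / 2 + ε / 2 := by
        refine add_le_add le_rfl ?_
        rw [div_le_iff₀ (by positivity)]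
        have : ε ^ 3 * m ≤ ε ^ 2 * m := by
          gcongr ?_ * m
          exact pow_le_pow_of_le_one hε0.le hε1 (by norm_num)
        nlinarith
    _ = ε := by ring
end

section
/- Let a, b, p ∈ ℤ with p ≥ 1 and a ≥ 0, let i1 ≤ i2 be integers, and let I = {i1, …, i2}. Let D = {(x, y) ∈ ℤ × ℤ : i1 ≤ x ≤ i2 and p·y ≤ a·x + b} be the set of integer points in the vertical strip lying on or below the line y = (ax+b)/p. Then there exists x* ∈ I minimizing (a·x + b) mod p over I such that the point (x*, ⌊(a·x* + b)/p⌋), viewed in ℝ², is an extreme point of the convex hull of D. -/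
theorem floor_intCast_div_intCast_of_pos (n p : ℤ) (hp : 0 < p) :
    ⌊(n : ℝ) / (p : ℝ)⌋ = n / p := by
  have hpR : (0 : ℝ) < p := by exact_mod_cast hp
  have h1 := Int.mul_ediv_add_emod n p
  have h2 := Int.emod_nonneg n hp.ne'
  have h3 := Int.emod_lt_of_pos n hp
  rw [Int.floor_eq_iff, le_div_iff₀ hpR, div_lt_iff₀ hpR]
  constructor
  · exact_mod_cast (by nlinarith : n / p * p ≤ n)
  · exact_mod_cast (by nlinarith : n < (n / p + 1) * p)

/-- A half-plane containing a set contains its convex hull. -/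
theorem le_on_convexHull_of_le {s : Set (ℝ × ℝ)} {u v c : ℝ}
    (h : ∀ z ∈ s, c ≤ u * z.1 + v * z.2) :
    ∀ z ∈ convexHull ℝ s, c ≤ u * z.1 + v * z.2 := by
  have hconv : Convex ℝ {z : ℝ × ℝ | c ≤ u * z.1 + v * z.2} :=
    convex_halfSpace_ge (f := fun z : ℝ × ℝ => u * z.1 + v * z.2)
      ⟨fun x y => by simp only [Prod.fst_add, Prod.snd_add]; ring,
        fun r x => by simp only [Prod.smul_fst, Prod.smul_snd, smul_eq_mul]; ring⟩ c
  exact fun z hz => convexHull_min h hconv hz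

theorem eq_of_convex_combination_eq_of_le {s t u v c : ℝ} (hs : 0 < s) (ht : 0 < t)
    (hst : s + t = 1) (hu : c ≤ u) (hv : c ≤ v) (h : s * u + t * v = c) : u = c ∧ v = c := by
  have h0 : s * (u - c) + t * (v - c) = 0 := by linear_combination h - c * hst
  have hsu := mul_nonneg hs.le (sub_nonneg.2 hu)
  have htv := mul_nonneg ht.le (sub_nonneg.2 hv)
  exact ⟨hu.antisymm' (sub_nonpos.1 (nonpos_of_mul_nonpos_right (by linarith) hs)),
    hv.antisymm' (sub_nonpos.1 (nonpos_of_mul_nonpos_right (by linarith) ht))⟩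

/-- If `z` minimizes a linear functional on `s`, and also its perturbation by the first coordinate,
then `z` is an extreme point of the convex hull. -/
theorem mem_extremePoints_convexHull_of_le_of_le {s : Set (ℝ × ℝ)} {z : ℝ × ℝ} {u v K : ℝ}
    (hv : v ≠ 0) (hz : z ∈ s) (h₁ : ∀ w ∈ s, u * z.1 + v * z.2 ≤ u * w.1 + v * w.2)
    (h₂ : ∀ w ∈ s, (K * u + 1) * z.1 + K * v * z.2 ≤ (K * u + 1) * w.1 + K * v * w.2) :
    z ∈ Set.extremePoints ℝ (convexHull ℝ s) := by
  refine ⟨subset_convexHull ℝ s hz, ?_⟩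
  rintro w hw w' hw' ⟨α, β, hα, hβ, hαβ, rfl⟩
  have e₁ := eq_of_convex_combination_eq_of_le hα hβ hαβ (le_on_convexHull_of_le h₁ w hw)
    (le_on_convexHull_of_le h₁ w' hw')
    (by simp only [Prod.fst_add, Prod.snd_add, Prod.smul_fst, Prod.smul_snd, smul_eq_mul]; ring)
  have e₂ := eq_of_convex_combination_eq_of_le hα hβ hαβ (le_on_convexHull_of_le h₂ w hw)
    (le_on_convexHull_of_le h₂ w' hw')
    (by simp only [Prod.fst_add, Prod.snd_add, Prod.smul_fst, Prod.smul_snd, smul_eq_mul]; ring)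
  have hfst : w.1 = (α • w + β • w').1 := by linear_combination e₂.1 - K * e₁.1
  refine Prod.ext hfst (mul_left_cancel₀ hv ?_)
  linear_combination e₁.1 - u * hfst

/-- The minimizer of `x ↦ (a·x+b) mod p` over `I = {i1,…,i2}` can be found among the
extreme points of the convex hull of the set `D` of integer points in the vertical
strip over `I` lying on or below the line `y = (ax+b)/p`. -/
theorem stmt6 (a b p i1 i2 : ℤ) (hp : 1 ≤ p) (ha : 0 ≤ a) (hi : i1 ≤ i2) :
    ∃ x0 ∈ Finset.Icc i1 i2,
      (∀ x ∈ Finset.Icc i1 i2, (a * x0 + b) % p ≤ (a * x + b) % p) ∧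
      (((x0 : ℝ), (⌊((a * x0 + b : ℤ) : ℝ) / (p : ℝ)⌋ : ℝ)) ∈
        Set.extremePoints ℝ (convexHull ℝ
          ((fun q : ℤ × ℤ => ((q.1 : ℝ), (q.2 : ℝ))) ''
            {q : ℤ × ℤ | i1 ≤ q.1 ∧ q.1 ≤ i2 ∧ p * q.2 ≤ a * q.1 + b}))) := by
  have hp0 : 0 < p := by lia
  obtain ⟨x0, hx0, hmin⟩ := Finset.exists_min_image (Finset.Icc i1 i2)
    (fun x => toLex ((a * x + b) % p, x)) ⟨i1, Finset.mem_Icc.2 ⟨le_rfl, hi⟩⟩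
  simp only [Prod.Lex.toLex_le_toLex] at hmin
  have hres : ∀ x ∈ Finset.Icc i1 i2, (a * x0 + b) % p ≤ (a * x + b) % p := fun x hx => by
    have := hmin x hx
    lia
  refine ⟨x0, hx0, hres, ?_⟩
  rw [floor_intCast_div_intCast_of_pos _ _ hp0]
  have hdiv := Int.mul_ediv_add_emod (a * x0 + b) p
  have hnonneg := Int.emod_nonneg (a * x0 + b) hp0.ne'
  set y0 := (a * x0 + b) / p
  have hx0' := Finset.mem_Icc.1 hx0
  have hmod : ∀ x y : ℤ, p * y ≤ a * x + b → (a * x + b) % p ≤ a * x + b - p * y := by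
    intro x y h
    have h1 := Int.mul_ediv_add_emod (a * x + b) p
    have h2 : y ≤ (a * x + b) / p := (Int.le_ediv_iff_mul_le hp0).2 (by linarith)
    nlinarith
  refine mem_extremePoints_convexHull_of_le_of_le (u := a) (v := -p)
    (K := ((i2 - i1 : ℤ) : ℝ)) (neg_ne_zero.2 (by exact_mod_cast hp0.ne'))
    ⟨(x0, y0), ⟨hx0'.1, hx0'.2, by lia⟩, rfl⟩ ?_ ?_
  · rintro _ ⟨⟨x, y⟩, ⟨h1, h2, h3⟩, rfl⟩
    have hr := hres x (Finset.mem_Icc.2 ⟨h1, h2⟩)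
    have hm := hmod x y h3
    dsimp only at *
    exact_mod_cast (by linarith : a * x0 + -p * y0 ≤ a * x + -p * y)
  · rintro _ ⟨⟨x, y⟩, ⟨h1, h2, h3⟩, rfl⟩
    have hr := hmin x (Finset.mem_Icc.2 ⟨h1, h2⟩)
    have hm := hmod x y h3
    dsimp only at *
    suffices h : x0 ≤ (i2 - i1) * ((a * x - p * y) - (a * x0 - p * y0)) + x by
      exact_mod_cast (by linarith : ((i2 - i1) * a + 1) * x0 + (i2 - i1) * -p * y0 ≤
        ((i2 - i1) * a + 1) * x + (i2 - i1) * -p * y)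
    rcases hr with hr | ⟨hr, hx⟩
    · have : 1 ≤ (a * x - p * y) - (a * x0 - p * y0) := by lia
      nlinarith
    · have : 0 ≤ (a * x - p * y) - (a * x0 - p * y0) := by lia
      nlinarith
end

section
/- Let 0 < ε ≤ 1 and let a, b, u, ã, b̃, ũ be real numbers with u > 0, 0 ≤ a ≤ u, 0 ≤ b ≤ u, u ≤ a + b, |ã − a| ≤ (ε/8)·a, |b̃ − b| ≤ (ε/8)·b, and |ũ − u| ≤ (ε/8)·u. Then ũ > 0 and |(ã + b̃ − ũ)/ũ − (a + b − u)/u| < ε. -/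
/-- Arithmetic core of Lemma 7: if `a = |S|`, `b = |T|`, `u = |S∪T|` and
`a', b', u'` are estimates with relative error at most `ε/8`, then `u' > 0` and the
estimated Jaccard similarity `(a'+b'−u')/u'` differs from `(a+b−u)/u` by less
than `ε`. -/
theorem stmt13 (ε a b u a' b' u' : ℝ) (hε0 : 0 < ε) (hε1 : ε ≤ 1) (hu : 0 < u)
    (ha0 : 0 ≤ a) (hau : a ≤ u) (hb0 : 0 ≤ b) (hbu : b ≤ u) (huab : u ≤ a + b)
    (ha' : |a' - a| ≤ ε / 8 * a) (hb' : |b' - b| ≤ ε / 8 * b)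
    (hu' : |u' - u| ≤ ε / 8 * u) :
    0 < u' ∧ |(a' + b' - u') / u' - (a + b - u) / u| < ε := by
  obtain ⟨ha1, ha2⟩ := abs_le.mp ha'
  obtain ⟨hb1, hb2⟩ := abs_le.mp hb'
  obtain ⟨hu1, hu2⟩ := abs_le.mp hu'
  have hu'_lower : 7 / 8 * u ≤ u' := by nlinarith
  have hu'_pos : 0 < u' := by linarith
  refine ⟨hu'_pos, ?_⟩
  have hdiff : (a' + b' - u') / u' - (a + b - u) / u
      = (u * (a' + b' - (a + b)) - (a + b) * (u' - u)) / (u' * u) := by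
    field_simp
    ring
  have hsum : |a' + b' - (a + b)| ≤ ε / 8 * (a + b) := by
    rw [abs_le]
    constructor <;> linarith
  have hnum : |u * (a' + b' - (a + b)) - (a + b) * (u' - u)| ≤ ε / 2 * (u * u) := by
    calc |u * (a' + b' - (a + b)) - (a + b) * (u' - u)|
        ≤ |u * (a' + b' - (a + b))| + |(a + b) * (u' - u)| := abs_sub _ _
      _ = u * |a' + b' - (a + b)| + (a + b) * |u' - u| := by
          rw [abs_mul, abs_mul, abs_of_pos hu, abs_of_nonneg (add_nonneg ha0 hb0)]
      _ ≤ u * (ε / 8 * (a + b)) + (a + b) * (ε / 8 * u) := by gcongr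
      _ = ε / 4 * u * (a + b) := by ring
      _ ≤ ε / 4 * u * (u + u) := by gcongr
      _ = ε / 2 * (u * u) := by ring
  rw [hdiff, abs_div, abs_of_pos (mul_pos hu'_pos hu), div_lt_iff₀ (mul_pos hu'_pos hu)]
  calc |u * (a' + b' - (a + b)) - (a + b) * (u' - u)| ≤ ε / 2 * (u * u) := hnum
    _ < ε * (7 / 8 * u * u) := by nlinarith [mul_pos hε0 (mul_pos hu hu)]
    _ ≤ ε * (u' * u) := by gcongr
end
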